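/- Intertwining of the tilde projections with the edge-adding operators: Θ_Z̃ Λ_Ỹ = Λ_Y Θ_Z̃ and Θ_Ỹ Λ_Z̃ = Λ_Z Θ_Ỹ on 𝒫_{Ỹ,Z̃}, i.e. for every f ∈ 𝒫_{Ỹ,Z̃}, Θ_Z̃(Λ_Ỹ f) = Λ_Y(Θ_Z̃ f) and Θ_Ỹ(Λ_Z̃ f) = Λ_Z(Θ_Ỹ f). -/

import Mathlib

open MvPolynomial

noncomputable section

/-- The base field `K = ℚ(b)`: rational functions in an indeterminate `b` over `ℚ`. -/
abbrev K : Type := RatFunc ℚ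

/-- The indeterminate `b ∈ K`. -/
def bb : K := RatFunc.X

/-- `α = 1 + b`. -/
def alpha : K := 1 + bb

/-- Variables: `p i` (used for `i ≥ 1`) and `y i`, `y' i`, `z i`, `z' i` (`i ≥ 0`). -/
inductive Var : Type
  | p : ℕ → Var
  | y : ℕ → Var
  | y' : ℕ → Var
  | z : ℕ → Var
  | z' : ℕ → Var
  deriving DecidableEq

/-- The ambient polynomial ring `R′`. -/
abbrev R : Type := MvPolynomial Var K

/-- The generic operator
`Λ_A = α Σ_{i,j≥1} i a_{i+j−1} ∂²/∂p_i∂a_{j−1} + Σ_{i,j≥1} a_{i−1} p_j ∂/∂a_{i+j−1}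
     + b Σ_{i≥1} i a_i ∂/∂a_i` for the alphabet `a ∈ {y, y′, z, z′}`. -/
def Lam (a : ℕ → Var) (f : R) : R :=
  alpha • (∑ᶠ (i : ℕ) (j : ℕ), ((i + 1 : ℕ) : K) •
      (X (a (i + j + 1)) * pderiv (Var.p (i + 1)) (pderiv (a j) f)))
    + (∑ᶠ (i : ℕ) (j : ℕ), X (a i) * X (Var.p (j + 1)) * pderiv (a (i + j + 1)) f)
    + bb • (∑ᶠ (i : ℕ), ((i + 1 : ℕ) : K) • (X (a (i + 1)) * pderiv (a (i + 1)) f))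

/-- The generic shift operator `A_+ = Σ_{i≥0} a_{i+1} ∂/∂a_i`. -/
def Plus (a : ℕ → Var) (f : R) : R := ∑ᶠ (i : ℕ), X (a (i + 1)) * pderiv (a i) f

/-- The generic operator `Θ_A = Σ_{i≥1} p_i ∂/∂a_i`. -/
def Theta (a : ℕ → Var) (f : R) : R := ∑ᶠ (i : ℕ), X (Var.p (i + 1)) * pderiv (a (i + 1)) f

/-- `M_Z = α Σ_{i,j,k≥1} y′_{i+j−1} z′_{k−1} ∂²/∂y_{i+k−1}∂z_{j−1}
         + Σ_{i,j,k≥1} y_{i+j−1} z_{k−1} ∂²/∂y′_{i+k−1}∂z′_{j−1}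
         + b Σ_{i,j,k≥1} y′_{i+j−1} z′_{k−1} ∂²/∂y′_{i+k−1}∂z′_{j−1}`. -/
def MZ (f : R) : R :=
  alpha • (∑ᶠ (i : ℕ) (j : ℕ) (k : ℕ), X (Var.y' (i + j + 1)) * X (Var.z' k) *
      pderiv (Var.y (i + k + 1)) (pderiv (Var.z j) f))
    + (∑ᶠ (i : ℕ) (j : ℕ) (k : ℕ), X (Var.y (i + j + 1)) * X (Var.z k) *
      pderiv (Var.y' (i + k + 1)) (pderiv (Var.z' j) f))
    + bb • (∑ᶠ (i : ℕ) (j : ℕ) (k : ℕ), X (Var.y' (i + j + 1)) * X (Var.z' k) *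
      pderiv (Var.y' (i + k + 1)) (pderiv (Var.z' j) f))

/-- `M_Y`: obtained from `M_Z` by exchanging `y ↔ z` and `y′ ↔ z′` everywhere. -/
def MY (f : R) : R :=
  alpha • (∑ᶠ (i : ℕ) (j : ℕ) (k : ℕ), X (Var.z' (i + j + 1)) * X (Var.y' k) *
      pderiv (Var.z (i + k + 1)) (pderiv (Var.y j) f))
    + (∑ᶠ (i : ℕ) (j : ℕ) (k : ℕ), X (Var.z (i + j + 1)) * X (Var.y k) *
      pderiv (Var.z' (i + k + 1)) (pderiv (Var.y' j) f))
    + bb • (∑ᶠ (i : ℕ) (j : ℕ) (k : ℕ), X (Var.z' (i + j + 1)) * X (Var.y' k) *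
      pderiv (Var.z' (i + k + 1)) (pderiv (Var.y' j) f))

/-- `Λ_Ỹ = Λ_Y + Λ_{Y′} + M_Y`. -/
def LamYt (f : R) : R := Lam Var.y f + Lam Var.y' f + MY f

/-- `Λ_Z̃ = Λ_Z + Λ_{Z′} + M_Z`. -/
def LamZt (f : R) : R := Lam Var.z f + Lam Var.z' f + MZ f

/-- `Ỹ_+ = Y_+ + Y′_+`. -/
def Ytplus (f : R) : R := Plus Var.y f + Plus Var.y' f

/-- `Z̃_+ = Z_+ + Z′_+`. -/
def Ztplus (f : R) : R := Plus Var.z f + Plus Var.z' f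

/-- `Θ_Z̃ = ∂/∂z₀ + Σ_{i≥1} p_i ∂/∂z_i + Σ_{i,j≥0} y_{i+j} ∂²/∂y′_i∂z′_j`. -/
def ThZt (f : R) : R :=
  pderiv (Var.z 0) f + (∑ᶠ (i : ℕ), X (Var.p (i + 1)) * pderiv (Var.z (i + 1)) f)
    + (∑ᶠ (i : ℕ) (j : ℕ), X (Var.y (i + j)) * pderiv (Var.y' i) (pderiv (Var.z' j) f))

/-- `Θ_Ỹ = ∂/∂y₀ + Σ_{i≥1} p_i ∂/∂y_i + Σ_{i,j≥0} z_{i+j} ∂²/∂z′_i∂y′_j`. -/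
def ThYt (f : R) : R :=
  pderiv (Var.y 0) f + (∑ᶠ (i : ℕ), X (Var.p (i + 1)) * pderiv (Var.y (i + 1)) f)
    + (∑ᶠ (i : ℕ) (j : ℕ), X (Var.z (i + j)) * pderiv (Var.z' i) (pderiv (Var.y' j) f))

/-- `Δ = α Σ_{i,j≥0} z′_i y′_j ∂²/∂y_i∂z_j + Σ_{i,j≥0} z_i y_j ∂²/∂y′_i∂z′_j
      + b Σ_{i,j≥0} z′_i y′_j ∂²/∂y′_i∂z′_j`. -/
def Delta (f : R) : R :=
  alpha • (∑ᶠ (i : ℕ) (j : ℕ), X (Var.z' i) * X (Var.y' j) *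
      pderiv (Var.y i) (pderiv (Var.z j) f))
    + (∑ᶠ (i : ℕ) (j : ℕ), X (Var.z i) * X (Var.y j) *
      pderiv (Var.y' i) (pderiv (Var.z' j) f))
    + bb • (∑ᶠ (i : ℕ) (j : ℕ), X (Var.z' i) * X (Var.y' j) *
      pderiv (Var.y' i) (pderiv (Var.z' j) f))

/-- `𝒫`: the subalgebra of polynomials in the `p`-variables only. -/
def Psub : Subalgebra K R := MvPolynomial.supported K (Set.range Var.p)

/-- `𝒫_Y`: the `K`-linear span of the monomials `p_λ` and `y_i·p_λ`. -/
def PY : Submodule K R :=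
  Submodule.span K ((Psub : Set R) ∪
    {g : R | ∃ i : ℕ, ∃ f ∈ (Psub : Set R), g = X (Var.y i) * f})

/-- `𝒫_{Ỹ,Z̃}`: the `K`-linear span of the monomials
`p_λ, y_i·p_λ, z_j·p_λ, y_i·z_j·p_λ, y′_i·p_λ, z′_j·p_λ, y′_i·z′_j·p_λ`. -/
def PYZt : Submodule K R :=
  Submodule.span K ((Psub : Set R) ∪
    {g : R | ∃ f ∈ (Psub : Set R),
      (∃ i : ℕ, g = X (Var.y i) * f) ∨ (∃ j : ℕ, g = X (Var.z j) * f) ∨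
      (∃ i : ℕ, ∃ j : ℕ, g = X (Var.y i) * X (Var.z j) * f) ∨
      (∃ i : ℕ, g = X (Var.y' i) * f) ∨ (∃ j : ℕ, g = X (Var.z' j) * f) ∨
      (∃ i : ℕ, ∃ j : ℕ, g = X (Var.y' i) * X (Var.z' j) * f)})

/-- The alphabets `y`, `y'`, `z`, `z'`, indexed by a side (`z` or not) and a prime (or not). -/
def letter : Bool → Bool → ℕ → Var
  | false, false => Var.y
  | false, true => Var.y'
  | true, false => Var.z
  | true, true => Var.z'

/-- The index of a variable in its alphabet. -/
def Var.idx : Var → ℕ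
  | .p i => i
  | .y i => i
  | .y' i => i
  | .z i => i
  | .z' i => i

@[simp]
lemma idx_letter (s t : Bool) (i : ℕ) : (letter s t i).idx = i := by
  cases s <;> cases t <;> rfl

@[simp]
lemma letter_inj {s t s' t' : Bool} {i j : ℕ} :
    letter s t i = letter s' t' j ↔ s = s' ∧ t = t' ∧ i = j := by
  cases s <;> cases t <;> cases s' <;> cases t' <;> simp [letter]

lemma letter_ne_p (s t : Bool) (i j : ℕ) : letter s t i ≠ Var.p j := by
  cases s <;> cases t <;> simp [letter]

@[simp]
lemma pderiv_letter_X_letter (s t s' t' : Bool) (i j : ℕ) :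
    pderiv (letter s t i) (X (letter s' t' j) : R) =
      if s' = s ∧ t' = t ∧ j = i then 1 else 0 := by
  simp [pderiv_X, Pi.single_apply]

@[simp]
lemma pderiv_letter_X_p (s t : Bool) (i j : ℕ) :
    pderiv (letter s t i) (X (Var.p j) : R) = 0 :=
  pderiv_X_of_ne (letter_ne_p s t i j).symm

@[simp]
lemma pderiv_p_X_letter (s t : Bool) (i j : ℕ) :
    pderiv (Var.p j) (X (letter s t i) : R) = 0 :=
  pderiv_X_of_ne (letter_ne_p s t i j)

lemma pderiv_comm {σ A : Type*} [CommRing A] (i j : σ) (f : MvPolynomial σ A) :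
    pderiv (R := A) i (pderiv j f) = pderiv j (pderiv i f) := by
  classical
  have h : ⁅(pderiv i : Derivation A (MvPolynomial σ A) (MvPolynomial σ A)),
      (pderiv j : Derivation A (MvPolynomial σ A) (MvPolynomial σ A))⁆ = 0 := by
    refine derivation_ext fun k => ?_
    simp [Derivation.commutator_apply, pderiv_X, Pi.single_apply, apply_ite]
  have h' := congrArg (fun D : Derivation A (MvPolynomial σ A) (MvPolynomial σ A) => D f) h
  simpa [Derivation.commutator_apply, sub_eq_zero] using h'

lemma exists_forall_pderiv_eq_zero (f : R) :
    ∃ N, ∀ v : Var, N ≤ v.idx → pderiv v f = 0 := by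
  refine ⟨f.vars.sup Var.idx + 1, fun v hv => pderiv_eq_zero_of_notMem_vars fun h => ?_⟩
  have := Finset.le_sup (f := Var.idx) h
  omega

lemma isLinearMap_finsum {F : ℕ → R → R} (hF : ∀ i, IsLinearMap K (F i))
    (hfin : ∀ f, ∃ N, ∀ i ≥ N, F i f = 0) : IsLinearMap K fun f => ∑ᶠ i, F i f := by
  have hs : ∀ f, Function.HasFiniteSupport fun i => F i f := fun f => by
    obtain ⟨N, hN⟩ := hfin f
    refine (Set.finite_Iio N).subset fun i hi => ?_
    by_contra h
    exact hi (hN i (not_lt.mp h))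
  constructor
  · intro f g
    simp only [(hF _).map_add]
    exact finsum_add_distrib (hs f) (hs g)
  · intro c f
    simp only [(hF _).map_smul]
    exact (smul_finsum' c (hs f)).symm

lemma isLinearMap_mul_pderiv (c : R) (v : Var) : IsLinearMap K fun f : R => c * pderiv v f :=
  (LinearMap.mulLeft K c ∘ₗ (pderiv v).toLinearMap).isLinear

lemma isLinearMap_mul_pderiv_pderiv (c : R) (v w : Var) :
    IsLinearMap K fun f : R => c * pderiv v (pderiv w f) :=
  (LinearMap.mulLeft K c ∘ₗ (pderiv v).toLinearMap ∘ₗ (pderiv w).toLinearMap).isLinear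

lemma IsLinearMap.const_smul {F : R → R} (hF : IsLinearMap K F) (c : K) :
    IsLinearMap K fun f => c • F f :=
  (c • hF.mk' F).isLinear

lemma IsLinearMap.fun_add {F G : R → R} (hF : IsLinearMap K F) (hG : IsLinearMap K G) :
    IsLinearMap K fun f => F f + G f :=
  (hF.mk' F + hG.mk' G).isLinear

lemma isLinearMap_finsum_pderiv (c : ℕ → R) (v : ℕ → Var) (hv : ∀ i, i ≤ (v i).idx) :
    IsLinearMap K fun f : R => ∑ᶠ i, c i * pderiv (v i) f := by
  refine isLinearMap_finsum (fun i => isLinearMap_mul_pderiv _ _) fun f => ?_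
  obtain ⟨N, hN⟩ := exists_forall_pderiv_eq_zero f
  exact ⟨N, fun i hi => by rw [hN _ (hi.trans (hv i)), mul_zero]⟩

lemma isLinearMap_finsum_pderiv_pderiv (c : ℕ → R) (v w : ℕ → Var)
    (h : (∀ i, i ≤ (v i).idx) ∨ ∀ i, i ≤ (w i).idx) :
    IsLinearMap K fun f : R => ∑ᶠ i, c i * pderiv (v i) (pderiv (w i) f) := by
  refine isLinearMap_finsum (fun i => isLinearMap_mul_pderiv_pderiv _ _ _) fun f => ?_
  obtain ⟨N, hN⟩ := exists_forall_pderiv_eq_zero f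
  refine ⟨N, fun i hi => ?_⟩
  rcases h with h | h
  · rw [pderiv_comm, hN _ (hi.trans (h i)), map_zero, mul_zero]
  · rw [hN _ (hi.trans (h i)), map_zero, mul_zero]

lemma isLinearMap_Lam (s t : Bool) : IsLinearMap K (Lam (letter s t)) := by
  refine .fun_add (.fun_add (.const_smul ?_ _) ?_) (.const_smul ?_ _)
  · simp only [← smul_mul_assoc]
    refine isLinearMap_finsum (fun i => isLinearMap_finsum_pderiv_pderiv _ _ _ (.inr ?_))
      fun f => ?_
    · simp
    obtain ⟨N, hN⟩ := exists_forall_pderiv_eq_zero f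
    refine ⟨N, fun i hi => finsum_eq_zero_of_forall_eq_zero fun j => ?_⟩
    rw [pderiv_comm, hN (Var.p (i + 1)) (Nat.le_succ_of_le hi), map_zero, mul_zero]
  · refine isLinearMap_finsum (fun i => isLinearMap_finsum_pderiv _ _ fun j => ?_) fun f => ?_
    · rw [idx_letter]; omega
    obtain ⟨N, hN⟩ := exists_forall_pderiv_eq_zero f
    refine ⟨N, fun i hi => finsum_eq_zero_of_forall_eq_zero fun j => ?_⟩
    rw [hN _ (by rw [idx_letter]; omega), mul_zero]
  · simp only [← smul_mul_assoc]
    exact isLinearMap_finsum_pderiv _ _ (by simp)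

/-- The building block of `MY` and `MZ`. -/
def exchange (c d v w : ℕ → Var) (f : R) : R :=
  ∑ᶠ (i : ℕ) (j : ℕ) (k : ℕ), X (c (i + j + 1)) * X (d k) *
    pderiv (v (i + k + 1)) (pderiv (w j) f)

lemma isLinearMap_exchange (c d v w : ℕ → Var) (hv : ∀ i, (v i).idx = i)
    (hw : ∀ i, (w i).idx = i) : IsLinearMap K (exchange c d v w) := by
  refine isLinearMap_finsum (fun i => isLinearMap_finsum (fun j =>
    isLinearMap_finsum_pderiv_pderiv _ _ _ (.inl fun k => ?_)) fun f => ?_) fun f => ?_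
  · rw [hv]; omega
  all_goals obtain ⟨N, hN⟩ := exists_forall_pderiv_eq_zero f
  · refine ⟨N, fun j hj => finsum_eq_zero_of_forall_eq_zero fun k => ?_⟩
    rw [hN _ (by rwa [hw]), map_zero, mul_zero]
  · refine ⟨N, fun i hi => finsum_eq_zero_of_forall_eq_zero fun j =>
      finsum_eq_zero_of_forall_eq_zero fun k => ?_⟩
    rw [pderiv_comm, hN _ (by rw [hv]; omega), map_zero, mul_zero]

/-- The common form of `LamYt` (`s = false`) and `LamZt` (`s = true`). -/
def LamTilde (s : Bool) (f : R) : R :=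
  Lam (letter s false) f + Lam (letter s true) f +
    (alpha • exchange (letter (!s) true) (letter s true) (letter (!s) false) (letter s false) f
      + exchange (letter (!s) false) (letter s false) (letter (!s) true) (letter s true) f
      + bb • exchange (letter (!s) true) (letter s true) (letter (!s) true) (letter s true) f)

/-- The common form of `ThZt` (`s = false`) and `ThYt` (`s = true`). -/
def ThetaTilde (s : Bool) (f : R) : R :=
  pderiv (letter (!s) false 0) f
    + (∑ᶠ (i : ℕ), X (Var.p (i + 1)) * pderiv (letter (!s) false (i + 1)) f)
    + (∑ᶠ (i : ℕ) (j : ℕ), X (letter s false (i + j)) *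
        pderiv (letter s true i) (pderiv (letter (!s) true j) f))

lemma isLinearMap_LamTilde (s : Bool) : IsLinearMap K (LamTilde s) := by
  refine .fun_add (.fun_add (isLinearMap_Lam _ _) (isLinearMap_Lam _ _))
    (.fun_add (.fun_add (.const_smul ?_ _) ?_) (.const_smul ?_ _)) <;>
  exact isLinearMap_exchange _ _ _ _ (idx_letter _ _) (idx_letter _ _)

lemma isLinearMap_ThetaTilde (s : Bool) : IsLinearMap K (ThetaTilde s) := by
  refine .fun_add (.fun_add (pderiv _).toLinearMap.isLinear ?_) ?_
  · exact isLinearMap_finsum_pderiv _ _ (by simp)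
  · refine isLinearMap_finsum (fun i => isLinearMap_finsum_pderiv_pderiv _ _ _ (.inr ?_))
      fun f => ?_
    · simp
    obtain ⟨N, hN⟩ := exists_forall_pderiv_eq_zero f
    refine ⟨N, fun i hi => finsum_eq_zero_of_forall_eq_zero fun j => ?_⟩
    rw [pderiv_comm, hN _ (by simpa using hi), map_zero, mul_zero]

lemma ThetaTilde_add (s : Bool) (f g : R) :
    ThetaTilde s (f + g) = ThetaTilde s f + ThetaTilde s g :=
  (isLinearMap_ThetaTilde s).map_add f g

lemma ThetaTilde_smul (s : Bool) (c : K) (f : R) :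
    ThetaTilde s (c • f) = c • ThetaTilde s f :=
  (isLinearMap_ThetaTilde s).map_smul c f

lemma ThetaTilde_sum (s : Bool) {ι : Type*} (u : Finset ι) (f : ι → R) :
    ThetaTilde s (∑ i ∈ u, f i) = ∑ i ∈ u, ThetaTilde s (f i) :=
  map_sum ((isLinearMap_ThetaTilde s).mk' _) f u

lemma finsum_finsum_ite_add_succ_eq {M : Type*} [AddCommMonoid M] (n : ℕ) (F : ℕ → ℕ → M) :
    ∑ᶠ (i : ℕ) (j : ℕ), (if n = i + j + 1 then F i j else 0) =
      ∑ j ∈ Finset.range n, F (n - 1 - j) j := by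
  rw [← Finset.sum_range_reflect]
  have h : ∀ i, ∑ᶠ j, (if n = i + j + 1 then F i j else 0) =
      if i < n then F i (n - 1 - i) else 0 := by
    intro i
    rw [finsum_eq_single _ (n - 1 - i) fun j hj => if_neg (by omega)]
    exact if_congr (by omega) rfl rfl
  simp only [h]
  rw [finsum_eq_sum_of_support_subset (s := Finset.range n)]
  · refine Finset.sum_congr rfl fun i hi => ?_
    rw [Finset.mem_range] at hi
    rw [if_pos hi, show n - 1 - (n - 1 - i) = i by omega]
  · intro i hi
    simpa using (ite_ne_right_iff.mp hi).1

lemma Lam_eq_zero {a : ℕ → Var} {f : R} (hf : ∀ j, pderiv (a j) f = 0) : Lam a f = 0 := by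
  simp [Lam, hf]

lemma Lam_X_mul (s t : Bool) (n N : ℕ) {q : R} (hq : ∀ j, pderiv (letter s t j) q = 0)
    (hN : ∀ k ≥ N, pderiv (Var.p (k + 1)) q = 0) :
    Lam (letter s t) (X (letter s t n) * q) =
      alpha • ∑ k ∈ Finset.range N,
          ((k + 1 : ℕ) : K) • (X (letter s t (n + k + 1)) * pderiv (Var.p (k + 1)) q)
        + ∑ j ∈ Finset.range n, X (letter s t j) * X (Var.p (n - j)) * q
        + bb • ((n : K) • (X (letter s t n) * q)) := by
  have hd : ∀ j, pderiv (letter s t j) (X (letter s t n) * q) = if n = j then q else 0 := by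
    intro j
    simp [hq, -pderiv_X]
  unfold Lam
  simp only [hd]
  congr 2
  · congr 1
    have h : ∀ i, ∑ᶠ j, ((i + 1 : ℕ) : K) • (X (letter s t (i + j + 1)) *
        pderiv (Var.p (i + 1)) (if n = j then q else 0)) =
        ((i + 1 : ℕ) : K) • (X (letter s t (n + i + 1)) * pderiv (Var.p (i + 1)) q) := by
      intro i
      rw [finsum_eq_single _ n fun j hj => by simp [hj.symm], if_pos rfl, add_comm i n]
    simp only [h]
    refine finsum_eq_sum_of_support_subset _ fun i hi => ?_
    by_contra hc
    exact hi (by simp [hN i (by simpa using hc)])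
  · have h := finsum_finsum_ite_add_succ_eq n
      fun i j => X (letter s t i) * X (Var.p (j + 1)) * q
    simp only [mul_ite, mul_zero]
    rw [h, ← Finset.sum_range_reflect]
    refine Finset.sum_congr rfl fun j hj => ?_
    rw [Finset.mem_range] at hj
    rw [show n - 1 - (n - 1 - j) = j by omega, show n - 1 - j + 1 = n - j by omega]
  · cases n with
    | zero => simp
    | succ n =>
      rw [finsum_eq_single _ n fun j hj => by simp [hj.symm]]
      simp

lemma exchange_eq_zero_left {c d v w : ℕ → Var} {f : R} (hf : ∀ j, pderiv (v j) f = 0) :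
    exchange c d v w f = 0 := by
  simp [exchange, pderiv_comm (v _), hf]

lemma exchange_eq_zero_right {c d v w : ℕ → Var} {f : R} (hf : ∀ j, pderiv (w j) f = 0) :
    exchange c d v w f = 0 := by
  simp [exchange, hf]

/-- `q` involves none of the variables `y`, `y'`, `z`, `z'`. -/
def LetterFree (q : R) : Prop := ∀ s t i, pderiv (letter s t i) q = 0

lemma letterFree_of_mem_Psub {q : R} (hq : q ∈ Psub) : LetterFree q := by
  intro s t i
  refine pderiv_eq_zero_of_notMem_vars fun h => ?_
  obtain ⟨j, hj⟩ := (mem_supported.mp hq) h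
  exact letter_ne_p s t i j hj.symm

lemma LetterFree.pderiv_p {q : R} (hq : LetterFree q) (k : ℕ) :
    LetterFree (pderiv (Var.p k) q) := by
  intro s t i
  rw [pderiv_comm, hq, map_zero]

lemma exchange_X_mul_X (c d : ℕ → Var) (s t t' : Bool) (n m : ℕ) {q : R} (hq : LetterFree q) :
    exchange c d (letter (!s) t') (letter s t) (X (letter s t n) * (X (letter (!s) t' m) * q)) =
      ∑ k ∈ Finset.range m, X (c (m - 1 - k + n + 1)) * X (d k) * q := by
  rw [← finsum_finsum_ite_add_succ_eq m fun i k => X (c (i + n + 1)) * X (d k) * q]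
  refine finsum_congr fun i => ?_
  rw [finsum_eq_single _ n]
  · refine finsum_congr fun k => ?_
    simp [hq _ _ _, -pderiv_X]
  · intro j hj
    refine finsum_eq_zero_of_forall_eq_zero fun k => ?_
    simp [hq _ _ _, hj.symm, -pderiv_X]

/-- The power sum `p_n`, with the convention `p_0 = 1`. -/
def powerSum : ℕ → R
  | 0 => 1
  | n + 1 => X (Var.p (n + 1))

lemma powerSum_of_pos {n : ℕ} (hn : 0 < n) : powerSum n = X (Var.p n) := by
  cases n with
  | zero => omega
  | succ n => rfl

lemma letterFree_powerSum (n : ℕ) : LetterFree (powerSum n) := by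
  intro s t i
  cases n <;> simp [powerSum, -pderiv_X]

lemma pderiv_p_powerSum (k n : ℕ) :
    pderiv (Var.p (k + 1)) (powerSum n) = if n = k + 1 then 1 else 0 := by
  cases n <;> simp [powerSum, pderiv_X, Pi.single_apply]

lemma ThetaTilde_eq_zero {s : Bool} {f : R} (hf : ∀ t j, pderiv (letter (!s) t j) f = 0) :
    ThetaTilde s f = 0 := by
  simp [ThetaTilde, hf]

lemma ThetaTilde_X_mul {s : Bool} (n : ℕ) {q : R}
    (hq : ∀ t j, pderiv (letter (!s) t j) q = 0) :
    ThetaTilde s (X (letter (!s) false n) * q) = powerSum n * q := by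
  cases n with
  | zero => simp [ThetaTilde, hq, powerSum, -pderiv_X]
  | succ n =>
    simp only [ThetaTilde]
    rw [finsum_eq_single _ n fun j hj => by simp [hq, hj.symm, -pderiv_X]]
    simp [hq, powerSum, -pderiv_X]

lemma ThetaTilde_X_prime_mul {s : Bool} (n : ℕ) {q : R} (hq : LetterFree q) :
    ThetaTilde s (X (letter (!s) true n) * q) = 0 := by
  have h : ∀ i j, pderiv (letter s true i) (pderiv (letter (!s) true j)
      (X (letter (!s) true n) * q)) = 0 := by
    intro i j
    rw [pderiv_comm]
    simp [hq _ _ _, -pderiv_X]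
  simp [ThetaTilde, h, -pderiv_X, -Derivation.leibniz]
  simp [hq _ _ _, -pderiv_X]

lemma ThetaTilde_X_mul_X {s : Bool} (n m : ℕ) {q : R} (hq : LetterFree q) :
    ThetaTilde s (X (letter s true n) * (X (letter (!s) true m) * q)) =
      X (letter s false (n + m)) * q := by
  have h₁ : ∀ j, pderiv (letter (!s) false j)
      (X (letter s true n) * (X (letter (!s) true m) * q)) = 0 := by
    simp [hq _ _ _, -pderiv_X]
  have h₂ : ∀ i j, pderiv (letter s true i) (pderiv (letter (!s) true j)
      (X (letter s true n) * (X (letter (!s) true m) * q))) =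
        if n = i ∧ m = j then q else 0 := by
    intro i j
    rw [pderiv_comm]
    by_cases hi : n = i <;> by_cases hj : m = j <;> simp [hq _ _ _, -pderiv_X, hi, hj]
  simp only [ThetaTilde, h₁, h₂, mul_zero, finsum_zero, zero_add]
  rw [finsum_eq_single _ n fun i hi => by simp [hi.symm],
    finsum_eq_single _ m fun j hj => by simp [hj.symm]]
  simp

lemma LamTilde_eq_zero {s : Bool} {f : R} (hf : ∀ t j, pderiv (letter s t j) f = 0) :
    LamTilde s f = 0 := by
  simp [LamTilde, Lam_eq_zero (hf _), exchange_eq_zero_right (hf _)]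

lemma exists_forall_pderiv_p_eq_zero (f : R) (m : ℕ) :
    ∃ N ≥ m, ∀ k ≥ N, pderiv (Var.p (k + 1)) f = 0 := by
  obtain ⟨N, hN⟩ := exists_forall_pderiv_eq_zero f
  exact ⟨max m N, le_max_left _ _, fun k hk =>
    hN _ (Nat.le_succ_of_le ((le_max_right m N).trans hk))⟩

lemma ThetaTilde_LamTilde_X (s t : Bool) (n : ℕ) {q : R} (hq : LetterFree q) :
    ThetaTilde s (LamTilde s (X (letter s t n) * q)) = 0 := by
  have hf : ∀ t' j, pderiv (letter (!s) t' j) (X (letter s t n) * q) = 0 := by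
    simp [hq _ _ _, -pderiv_X]
  obtain ⟨N, -, hN⟩ := exists_forall_pderiv_p_eq_zero q 0
  have hLam : ∀ t', t' ≠ t → Lam (letter s t') (X (letter s t n) * q) = 0 := fun t' ht =>
    Lam_eq_zero (by simp [hq _ _ _, ht.symm, -pderiv_X])
  have hL : LamTilde s (X (letter s t n) * q) = Lam (letter s t) (X (letter s t n) * q) := by
    simp only [LamTilde, exchange_eq_zero_left (hf _), smul_zero, add_zero]
    cases t
    · rw [hLam true (by decide), add_zero]
    · rw [hLam false (by decide), zero_add]
  rw [hL, Lam_X_mul s t n N (hq s t) hN]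
  refine ThetaTilde_eq_zero fun t' j => ?_
  simp [hq _ _ _, (hq.pderiv_p _) _ _ _, -pderiv_X]

lemma ThetaTilde_LamTilde_X_mul_X (s : Bool) (n m : ℕ) {q : R} (hq : LetterFree q) :
    ThetaTilde s (LamTilde s (X (letter s false n) * (X (letter (!s) false m) * q))) =
      Lam (letter s false) (powerSum m * (X (letter s false n) * q)) := by
  obtain ⟨N, hNm, hN⟩ := exists_forall_pderiv_p_eq_zero q m
  have hL : LamTilde s (X (letter s false n) * (X (letter (!s) false m) * q)) =
      Lam (letter s false) (X (letter s false n) * (X (letter (!s) false m) * q)) +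
      alpha • ∑ k ∈ Finset.range m,
        X (letter (!s) true (m - 1 - k + n + 1)) * X (letter s true k) * q := by
    have h₁ : ∀ j, pderiv (letter s true j)
        (X (letter s false n) * (X (letter (!s) false m) * q)) = 0 := by
      simp [hq _ _ _, -pderiv_X]
    simp only [LamTilde, Lam_eq_zero h₁, exchange_eq_zero_right h₁,
      exchange_X_mul_X _ _ _ _ _ _ _ hq]
    simp
  rw [hL, Lam_X_mul s false n N (by simp [hq _ _ _, -pderiv_X])
    (fun k hk => by simp [hN k hk, -pderiv_X]),
    mul_left_comm (powerSum m),
    Lam_X_mul s false n N (by simp [hq _ _ _, letterFree_powerSum m _ _ _])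
    (fun k hk => by simp [hN k hk, pderiv_p_powerSum]; omega)]
  have h₁ : ∀ a r, LetterFree r → ThetaTilde s (X (letter s false a) *
      (X (letter (!s) false m) * r)) = X (letter s false a) * (powerSum m * r) := by
    intro a r hr
    rw [mul_left_comm, ThetaTilde_X_mul _ (by simp [hr _ _ _, -pderiv_X]), mul_left_comm]
  have h₂ : ∀ k, ThetaTilde s (((k + 1 : ℕ) : K) • (X (letter s false (n + k + 1)) *
      pderiv (Var.p (k + 1)) (X (letter (!s) false m) * q))) =
      ((k + 1 : ℕ) : K) • (X (letter s false (n + k + 1)) *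
        (powerSum m * pderiv (Var.p (k + 1)) q)) := by
    intro k
    rw [pderiv_mul, pderiv_p_X_letter, zero_mul, zero_add, ThetaTilde_smul,
      h₁ _ _ (hq.pderiv_p _)]
  have h₃ : ∀ j, ThetaTilde s (X (letter s false j) * X (Var.p (n - j)) *
      (X (letter (!s) false m) * q)) =
      X (letter s false j) * X (Var.p (n - j)) * (powerSum m * q) := by
    intro j
    rw [mul_assoc, mul_left_comm (X (Var.p _)), h₁ _ _ fun _ _ _ => by simp [hq _ _ _, -pderiv_X]]
    ring
  have h₄ : ∀ k ∈ Finset.range m, ThetaTilde s (X (letter (!s) true (m - 1 - k + n + 1)) *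
      X (letter s true k) * q) = X (letter s false (n + m)) * q := by
    intro k hk
    rw [Finset.mem_range] at hk
    rw [mul_assoc, mul_left_comm, ThetaTilde_X_mul_X _ _ hq]
    congr 3
    omega
  have h₅ : ∑ k ∈ Finset.range N, ((k + 1 : ℕ) : K) • (X (letter s false (n + k + 1)) *
      pderiv (Var.p (k + 1)) (powerSum m * q)) =
      ∑ k ∈ Finset.range N, ((k + 1 : ℕ) : K) • (X (letter s false (n + k + 1)) *
        (powerSum m * pderiv (Var.p (k + 1)) q)) +
      (m : K) • (X (letter s false (n + m)) * q) := by
    simp only [pderiv_mul, pderiv_p_powerSum, mul_add, smul_add, Finset.sum_add_distrib]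
    rw [add_comm]
    congr 1
    cases m with
    | zero => simp
    | succ m =>
      rw [Finset.sum_eq_single_of_mem m (Finset.mem_range.mpr hNm) fun k _ hk => by simp [hk.symm]]
      simp [add_assoc]
  simp only [ThetaTilde_add, ThetaTilde_smul, ThetaTilde_sum, h₂, h₃, h₁ _ _ hq]
  rw [Finset.sum_congr rfl h₄, h₅, Finset.sum_const, Finset.card_range, ← Nat.cast_smul_eq_nsmul K,
    smul_add]
  abel

lemma ThetaTilde_LamTilde_X_mul_X_prime (s : Bool) (n m : ℕ) {q : R} (hq : LetterFree q) :
    ThetaTilde s (LamTilde s (X (letter s true n) * (X (letter (!s) true m) * q))) =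
      Lam (letter s false) (X (letter s false (n + m)) * q) := by
  obtain ⟨N, -, hN⟩ := exists_forall_pderiv_p_eq_zero q 0
  have hL : LamTilde s (X (letter s true n) * (X (letter (!s) true m) * q)) =
      Lam (letter s true) (X (letter s true n) * (X (letter (!s) true m) * q)) +
      (∑ k ∈ Finset.range m,
        X (letter (!s) false (m - 1 - k + n + 1)) * X (letter s false k) * q +
      bb • ∑ k ∈ Finset.range m,
        X (letter (!s) true (m - 1 - k + n + 1)) * X (letter s true k) * q) := by
    have h₁ : ∀ j, pderiv (letter s false j)
        (X (letter s true n) * (X (letter (!s) true m) * q)) = 0 := by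
      simp [hq _ _ _, -pderiv_X]
    simp only [LamTilde, Lam_eq_zero h₁, exchange_eq_zero_right h₁,
      exchange_X_mul_X _ _ _ _ _ _ _ hq]
    simp
  rw [hL, Lam_X_mul s true n N (by simp [hq _ _ _, -pderiv_X])
    (fun k hk => by simp [hN k hk, -pderiv_X]),
    Lam_X_mul s false (n + m) N (hq _ _) hN]
  have h₂ : ∀ k, ThetaTilde s (((k + 1 : ℕ) : K) • (X (letter s true (n + k + 1)) *
      pderiv (Var.p (k + 1)) (X (letter (!s) true m) * q))) =
      ((k + 1 : ℕ) : K) • (X (letter s false (n + m + k + 1)) * pderiv (Var.p (k + 1)) q) := by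
    intro k
    rw [pderiv_mul, pderiv_p_X_letter, zero_mul, zero_add, ThetaTilde_smul,
      ThetaTilde_X_mul_X _ _ (hq.pderiv_p _)]
    congr 4
    omega
  have h₃ : ∀ j ∈ Finset.range n, ThetaTilde s (X (letter s true j) * X (Var.p (n - j)) *
      (X (letter (!s) true m) * q)) =
      X (letter s false (m + j)) * X (Var.p (m + n - (m + j))) * q := by
    intro j hj
    rw [mul_assoc, mul_left_comm (X (Var.p _)),
      ThetaTilde_X_mul_X _ _ fun _ _ _ => by simp [hq _ _ _, -pderiv_X], add_comm j m,
      Nat.add_sub_add_left, mul_assoc]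
  have h₄ : ∀ k ∈ Finset.range m, ThetaTilde s (X (letter (!s) true (m - 1 - k + n + 1)) *
      X (letter s true k) * q) = X (letter s false (n + m)) * q := by
    intro k hk
    rw [Finset.mem_range] at hk
    rw [mul_assoc, mul_left_comm, ThetaTilde_X_mul_X _ _ hq]
    congr 3
    omega
  have h₅ : ∀ k ∈ Finset.range m, ThetaTilde s (X (letter (!s) false (m - 1 - k + n + 1)) *
      X (letter s false k) * q) = X (letter s false k) * X (Var.p (m + n - k)) * q := by
    intro k hk
    rw [Finset.mem_range] at hk
    rw [mul_assoc, ThetaTilde_X_mul _ (by simp [hq _ _ _, -pderiv_X]),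
      powerSum_of_pos (Nat.succ_pos _), show (m - 1 - k + n).succ = m + n - k by omega]
    ring
  simp only [ThetaTilde_add, ThetaTilde_smul, ThetaTilde_sum, h₂, ThetaTilde_X_mul_X _ _ hq]
  rw [Finset.sum_congr rfl h₃, Finset.sum_congr rfl h₄, Finset.sum_congr rfl h₅,
    Finset.sum_const, Finset.card_range, ← Nat.cast_smul_eq_nsmul K, add_comm n m,
    Finset.sum_range_add, Nat.cast_add, add_smul, smul_add]
  abel

/-- The generators of `PYZt`, for the sides `s` and `!s`. -/
def IsGenerator (s : Bool) (f : R) : Prop :=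
  ∃ q, LetterFree q ∧ (f = q ∨ (∃ t i, f = X (letter s t i) * q) ∨
    (∃ t j, f = X (letter (!s) t j) * q) ∨
    ∃ t i j, f = X (letter s t i) * (X (letter (!s) t j) * q))

lemma ThetaTilde_LamTilde_of_isGenerator {s : Bool} {f : R} (hf : IsGenerator s f) :
    ThetaTilde s (LamTilde s f) = Lam (letter s false) (ThetaTilde s f) := by
  have hT : ThetaTilde s 0 = 0 := (isLinearMap_ThetaTilde s).map_zero
  have hL : Lam (letter s false) 0 = 0 := (isLinearMap_Lam s false).map_zero
  obtain ⟨q, hq, rfl | ⟨t, i, rfl⟩ | ⟨t, j, rfl⟩ | ⟨t, i, j, rfl⟩⟩ := hf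
  · rw [LamTilde_eq_zero (hq _), ThetaTilde_eq_zero (hq _), hT, hL]
  · rw [ThetaTilde_LamTilde_X s t i hq, ThetaTilde_eq_zero, hL]
    simp [hq _ _ _, -pderiv_X]
  · rw [LamTilde_eq_zero (by simp [hq _ _ _, -pderiv_X]), hT]
    cases t
    · rw [ThetaTilde_X_mul j (hq _), Lam_eq_zero]
      simp [hq _ _ _, letterFree_powerSum j _ _ _]
    · rw [ThetaTilde_X_prime_mul j hq, hL]
  · cases t
    · rw [ThetaTilde_LamTilde_X_mul_X s i j hq, mul_left_comm (X (letter s false i)),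
        ThetaTilde_X_mul]
      simp [hq _ _ _, -pderiv_X]
    · rw [ThetaTilde_LamTilde_X_mul_X_prime s i j hq, ThetaTilde_X_mul_X i j hq]

lemma ThetaTilde_LamTilde_of_mem_span {s : Bool} {S : Set R} (hS : ∀ f ∈ S, IsGenerator s f)
    {f : R} (hf : f ∈ Submodule.span K S) :
    ThetaTilde s (LamTilde s f) = Lam (letter s false) (ThetaTilde s f) := by
  have h := LinearMap.eqOn_span (s := S)
    (f := (isLinearMap_ThetaTilde s).mk' ∘ₗ (isLinearMap_LamTilde s).mk')
    (g := (isLinearMap_Lam s false).mk' ∘ₗ (isLinearMap_ThetaTilde s).mk')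
    fun f hf => ThetaTilde_LamTilde_of_isGenerator (hS f hf)
  exact h hf

/-- **Intertwining of the tilde projections with the edge-adding operators**
(relation (4.7e) of Chapuy–Dołęga): `Θ_Z̃ Λ_Ỹ = Λ_Y Θ_Z̃` and `Θ_Ỹ Λ_Z̃ = Λ_Z Θ_Ỹ`
on `𝒫_{Ỹ,Z̃}`. -/
theorem Theta_tilde_intertwines_Lam :
    ∀ f ∈ PYZt,
      (ThZt (LamYt f) = Lam Var.y (ThZt f)) ∧
      (ThYt (LamZt f) = Lam Var.z (ThYt f)) := by
  refine fun f hf => ⟨ThetaTilde_LamTilde_of_mem_span (s := false) ?_ hf,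
    ThetaTilde_LamTilde_of_mem_span (s := true) ?_ hf⟩
  · rintro f (hf | ⟨q, hq, ⟨i, rfl⟩ | ⟨j, rfl⟩ | ⟨i, j, rfl⟩ | ⟨i, rfl⟩ | ⟨j, rfl⟩ | ⟨i, j, rfl⟩⟩)
    · exact ⟨f, letterFree_of_mem_Psub hf, .inl rfl⟩
    all_goals refine ⟨q, letterFree_of_mem_Psub hq, .inr ?_⟩
    · exact .inl ⟨false, i, rfl⟩
    · exact .inr (.inl ⟨false, j, rfl⟩)
    · exact .inr (.inr ⟨false, i, j, mul_assoc _ _ _⟩)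
    · exact .inl ⟨true, i, rfl⟩
    · exact .inr (.inl ⟨true, j, rfl⟩)
    · exact .inr (.inr ⟨true, i, j, mul_assoc _ _ _⟩)
  · rintro f (hf | ⟨q, hq, ⟨i, rfl⟩ | ⟨j, rfl⟩ | ⟨i, j, rfl⟩ | ⟨i, rfl⟩ | ⟨j, rfl⟩ | ⟨i, j, rfl⟩⟩)
    · exact ⟨f, letterFree_of_mem_Psub hf, .inl rfl⟩
    all_goals refine ⟨q, letterFree_of_mem_Psub hq, .inr ?_⟩
    · exact .inr (.inl ⟨false, i, rfl⟩)
    · exact .inl ⟨false, j, rfl⟩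
    · exact .inr (.inr ⟨false, j, i, (mul_assoc _ _ _).trans (mul_left_comm _ _ _)⟩)
    · exact .inr (.inl ⟨true, i, rfl⟩)
    · exact .inl ⟨true, j, rfl⟩
    · exact .inr (.inr ⟨true, j, i, (mul_assoc _ _ _).trans (mul_left_comm _ _ _)⟩)
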